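/- For ε₂ = 0, the function F₀ is a first integral of the critical subsystem M_{L₁}: at every point x ∈ ℝ⁹ with F₁(x) = 0 and F₂(x) = 0, the derivative of F₀ in virtue of the equations of motion vanishes, {H,F₀}(x) = 0. -/

import Mathlib

noncomputable section

/-- The phase space `ℝ⁹` with coordinates `(M₁,M₂,M₃,α₁,α₂,α₃,β₁,β₂,β₃)`. -/
abbrev V9 : Type := Fin 9 → ℝ

/-- Index of `M_i` among the nine coordinates. -/
def mIdx (i : Fin 3) : Fin 9 := ⟨i.1, by have := i.isLt; omega⟩
/-- Index of `α_i` among the nine coordinates. -/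
def aIdx (i : Fin 3) : Fin 9 := ⟨i.1 + 3, by have := i.isLt; omega⟩
/-- Index of `β_i` among the nine coordinates. -/
def bIdx (i : Fin 3) : Fin 9 := ⟨i.1 + 6, by have := i.isLt; omega⟩

/-- The Levi-Civita symbol `ε_{ijk} = ½(i−j)(j−k)(k−i)`. -/
def epsSym (i j k : Fin 3) : ℝ :=
  (((i.1 : ℝ) - (j.1 : ℝ)) * ((j.1 : ℝ) - (k.1 : ℝ)) * ((k.1 : ℝ) - (i.1 : ℝ))) / 2

/-- Partial derivative of `f : ℝ⁹ → ℝ` in the `i`-th coordinate direction. -/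
def pd (i : Fin 9) (f : V9 → ℝ) (x : V9) : ℝ := fderiv ℝ f x (Pi.single i 1)

/-- The Lie–Poisson bracket of the Lie coalgebra `e(3,2)*`. -/
def pb (f g : V9 → ℝ) (x : V9) : ℝ :=
  ∑ i : Fin 3, ∑ j : Fin 3, ∑ k : Fin 3, epsSym i j k *
    (pd (mIdx i) f x * pd (mIdx j) g x * x (mIdx k)
      + (pd (mIdx i) f x * pd (aIdx j) g x - pd (mIdx i) g x * pd (aIdx j) f x) * x (aIdx k)
      + (pd (mIdx i) f x * pd (bIdx j) g x - pd (mIdx i) g x * pd (bIdx j) f x) * x (bIdx k))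

/-- The Hamiltonian `H` of the generalized two-field gyrostat. -/
def Hfun (lam e1 e2 : ℝ) : V9 → ℝ := fun x =>
  x 0 ^ 2 + x 1 ^ 2 + 2 * x 2 ^ 2 + 2 * lam * x 2 - 2 * e2 * (x 3 + x 7)
    + 2 * e1 * (x 1 * x 5 - x 2 * x 4 + x 2 * x 6 - x 0 * x 8)

/-- The invariant relation `F₁ = M₃ + λ + ε₁(β₁ − α₂)`. -/
def F1 (lam e1 : ℝ) : V9 → ℝ := fun x => x 2 + lam + e1 * (x 6 - x 4)

/-- The invariant relation `F₂`. -/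
def F2 (lam e1 : ℝ) : V9 → ℝ := fun x =>
  x 2 ^ 3 + (e1 * (x 6 - x 4) + lam) * x 2 ^ 2
    + (x 0 ^ 2 + x 1 ^ 2 + 2 * e1 * (x 5 * x 1 - x 8 * x 0)) * x 2
    + e1 * ((x 1 ^ 2 - x 0 ^ 2) * (x 4 + x 6) + 2 * x 0 * x 1 * (x 3 - x 7))
    + lam * (x 0 ^ 2 + x 1 ^ 2)

/-- The first integral `F₀` of the critical subsystem `M_{L₁}`. -/
def F0 (lam e1 : ℝ) : V9 → ℝ := fun x =>
  2 * e1 * (-(x 3 + x 7) * x 2 ^ 2 - (x 3 + x 7) * (e1 * (x 6 - x 4) + lam) * x 2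
    - x 3 * x 0 ^ 2 - x 7 * x 1 ^ 2 - (x 4 + x 6) * x 0 * x 1
    + (e1 * (2 * x 3 * x 8 - x 6 * x 5 - x 4 * x 5) + lam * x 5) * x 0
    - (e1 * (2 * x 7 * x 5 - x 6 * x 8 - x 4 * x 8) - lam * x 8) * x 1)

theorem pd_const (i : Fin 9) (c : ℝ) (x : V9) : pd i (fun _ => c) x = 0 := by
  simp [pd]

theorem pd_coord (i j : Fin 9) (x : V9) :
    pd i (fun y => y j) x = if j = i then 1 else 0 := by
  simp [pd, fderiv_apply, Pi.single_apply]

theorem pd_neg (i : Fin 9) (f : V9 → ℝ) (x : V9) :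
    pd i (fun y => -f y) x = -pd i f x := by
  simp [pd, fderiv_fun_neg]

theorem pd_add (i : Fin 9) {f g : V9 → ℝ} {x : V9} (hf : DifferentiableAt ℝ f x)
    (hg : DifferentiableAt ℝ g x) :
    pd i (fun y => f y + g y) x = pd i f x + pd i g x := by
  simp [pd, fderiv_fun_add hf hg]

theorem pd_sub (i : Fin 9) {f g : V9 → ℝ} {x : V9} (hf : DifferentiableAt ℝ f x)
    (hg : DifferentiableAt ℝ g x) :
    pd i (fun y => f y - g y) x = pd i f x - pd i g x := by
  simp [pd, fderiv_fun_sub hf hg]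

theorem pd_mul (i : Fin 9) {f g : V9 → ℝ} {x : V9} (hf : DifferentiableAt ℝ f x)
    (hg : DifferentiableAt ℝ g x) :
    pd i (fun y => f y * g y) x = f x * pd i g x + g x * pd i f x := by
  simp [pd, fderiv_fun_mul hf hg]

theorem pd_Hfun (lam e1 : ℝ) (x : V9) (i : Fin 9) :
    pd i (Hfun lam e1 0) x =
      ![2 * x 0 - 2 * e1 * x 8, 2 * x 1 + 2 * e1 * x 5,
        4 * x 2 + 2 * lam + 2 * e1 * (x 6 - x 4),
        0, -(2 * e1 * x 2), 2 * e1 * x 1, 2 * e1 * x 2, 0, -(2 * e1 * x 0)] i := by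
  unfold Hfun
  simp (disch := fun_prop) only [pow_two, pd_add, pd_sub, pd_mul, pd_const, pd_coord]
  fin_cases i <;> simp <;> ring

theorem pd_F0 (lam e1 : ℝ) (x : V9) (i : Fin 9) :
    pd i (F0 lam e1) x =
      ![2 * e1 * (-(2 * x 3 * x 0) - (x 4 + x 6) * x 1
          + (e1 * (2 * x 3 * x 8 - x 6 * x 5 - x 4 * x 5) + lam * x 5)),
        2 * e1 * (-(2 * x 7 * x 1) - (x 4 + x 6) * x 0
          - (e1 * (2 * x 7 * x 5 - x 6 * x 8 - x 4 * x 8) - lam * x 8)),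
        2 * e1 * (-(2 * (x 3 + x 7) * x 2) - (x 3 + x 7) * (e1 * (x 6 - x 4) + lam)),
        2 * e1 * (-x 2 ^ 2 - (e1 * (x 6 - x 4) + lam) * x 2 - x 0 ^ 2 + 2 * e1 * x 8 * x 0),
        2 * e1 * ((x 3 + x 7) * e1 * x 2 - x 0 * x 1 - e1 * x 5 * x 0 + e1 * x 8 * x 1),
        2 * e1 * ((lam - e1 * (x 6 + x 4)) * x 0 - 2 * e1 * x 7 * x 1),
        2 * e1 * (-((x 3 + x 7) * e1 * x 2) - x 0 * x 1 - e1 * x 5 * x 0 + e1 * x 8 * x 1),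
        2 * e1 * (-x 2 ^ 2 - (e1 * (x 6 - x 4) + lam) * x 2 - x 1 ^ 2 - 2 * e1 * x 5 * x 1),
        2 * e1 * (2 * e1 * x 3 * x 0 + (e1 * (x 6 + x 4) + lam) * x 1)] i := by
  unfold F0
  simp (disch := fun_prop) only [pow_two, pd_add, pd_sub, pd_neg, pd_mul, pd_const, pd_coord]
  fin_cases i <;> simp [-mul_eq_mul_left_iff] <;> ring

/-- For `ε₂ = 0`, `F₀` is a first integral of the critical subsystem `M_{L₁}`:
`{H, F₀}` vanishes at every point with `F₁ = 0` and `F₂ = 0`. -/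
theorem F0_first_integral (lam e1 : ℝ) (x : V9)
    (h1 : F1 lam e1 x = 0) (h2 : F2 lam e1 x = 0) :
    pb (Hfun lam e1 0) (F0 lam e1) x = 0 := by
  obtain rfl : lam = -x 2 - e1 * (x 6 - x 4) := by
    unfold F1 at h1
    linarith
  unfold F2 at h2
  simp only [pb, pd_Hfun, pd_F0, Fin.sum_univ_three, epsSym, mIdx, aIdx, bIdx]
  simp
  linear_combination (2 * e1 * (x 6 - x 4)) * h2
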